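/- Let (X, σ_X) and (Y, σ_Y) be topologically mixing shifts of finite type, π : X → Y a factor map, α > 0, and φ_n(y) = log |π^{-1}[y_1⋯y_n]|^{1/(α+1)} with Φ = {φ_n}. Let ν be the weak* limit of a convergent subsequence of the measures ν_n (with ν_n([i_1⋯i_n]) = |π^{-1}[i_1⋯i_n]|^{1/(α+1)}/S_n), and set μ_n = (1/n)Σ_{i=0}^{n-1} σ_Y^i ν. Then any weak* limit point μ of {μ_n} is a σ_Y-invariant Gibbs measure for Φ: there exist C', C'' > 0 with C' ≤ μ([i_1⋯i_n]) / (e^{−nP(σ_Y,Φ)} |π^{-1}[i_1⋯i_n]|^{1/(α+1)}) ≤ C'' for every n-cylinder. -/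

import Mathlib

set_option linter.unusedSectionVars false
set_option linter.unusedVariables false
set_option maxHeartbeats 1000000

open MeasureTheory Filter Topology Set
open scoped ENNReal NNReal Classical

namespace Paper

/-- The shift map on the full sequence space over the alphabet `A`. -/
def shiftF (A : Type*) : (ℕ → A) → (ℕ → A) := fun x i => x (i + 1)

/-- A (one-sided) subshift over the alphabet `A`: a closed shift-invariant set of sequences. -/
structure Subshift (A : Type*) [TopologicalSpace A] : Type _ where
  carrier : Set (ℕ → A)
  isClosed : IsClosed carrier
  shift_mem : ∀ x ∈ carrier, shiftF A x ∈ carrier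

section Defs

variable {A B : Type*}
  [Fintype A] [TopologicalSpace A] [DiscreteTopology A]
  [MeasurableSpace A] [MeasurableSingletonClass A]
  [Fintype B] [TopologicalSpace B] [DiscreteTopology B]
  [MeasurableSpace B] [MeasurableSingletonClass B]

/-- The points of a subshift, as a subtype of the full sequence space. -/
abbrev Subshift.pt (X : Subshift A) : Type _ := ↥X.carrier

/-- The shift map of a subshift. -/
def Subshift.σ (X : Subshift A) : X.pt → X.pt :=
  fun x => ⟨shiftF A x.1, X.shift_mem x.1 x.2⟩

/-- `M(X, σ_X)`: the set of shift-invariant Borel probability measures on the subshift. -/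
def invP (X : Subshift A) : Set (ProbabilityMeasure X.pt) :=
  {μ | μ.toMeasure.map X.σ = μ.toMeasure}

/-- The cylinder set `[w₁ ⋯ wₙ]` of a word, inside the subshift. -/
def cyl (X : Subshift A) {n : ℕ} (w : Fin n → A) : Set X.pt :=
  {x | ∀ i : Fin n, x.1 (i : ℕ) = w i}

/-- The entropy of the partition of `X` into cylinders of length `n` w.r.t. `μ`. -/
noncomputable def blockH (X : Subshift A) (μ : ProbabilityMeasure X.pt) (n : ℕ) : ℝ :=
  ∑ w : Fin n → A, Real.negMulLog ((μ.toMeasure (cyl X w)).toReal)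

/-- The Kolmogorov–Sinai entropy `h_μ(σ_X)` of an invariant measure on a subshift: for
invariant measures the sequence `blockH` is subadditive, so the infimum below is the
usual limit `lim (1/n) H_n` over the generating sequence of cylinder partitions. -/
noncomputable def KS (X : Subshift A) (μ : ProbabilityMeasure X.pt) : ℝ :=
  ⨅ n : ℕ, blockH X μ (n + 1) / (n + 1)

/-- A one-block factor map between subshifts, given by a map on symbols. -/
structure Factor (X : Subshift A) (Y : Subshift B) where
  symb : A → B
  mem : ∀ x ∈ X.carrier, (fun i => symb (x i)) ∈ Y.carrier
  surj : ∀ y ∈ Y.carrier, ∃ x ∈ X.carrier, (fun i => symb (x i)) = y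

variable {X : Subshift A} {Y : Subshift B}

/-- The factor map `π : X → Y` induced by the one-block map on symbols. -/
def Factor.map (π : Factor X Y) : X.pt → Y.pt :=
  fun x => ⟨fun i => π.symb (x.1 i), π.mem x.1 x.2⟩

lemma Factor.measurable_map (π : Factor X Y) : Measurable π.map := by
  apply Measurable.subtype_mk
  apply measurable_pi_lambda
  intro i
  exact (measurable_of_countable π.symb).comp
    ((measurable_pi_apply i).comp measurable_subtype_coe)

/-- Push-forward `π μ` of a probability measure under the factor map. -/
noncomputable def Factor.push (π : Factor X Y) (μ : ProbabilityMeasure X.pt) :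
    ProbabilityMeasure Y.pt :=
  μ.map π.measurable_map.aemeasurable

/-- A word is allowable in `X` if it occurs (initially) in some point of `X`. -/
def allowW (X : Subshift A) {n : ℕ} (w : Fin n → A) : Prop :=
  ∃ x ∈ X.carrier, ∀ i : Fin n, x (i : ℕ) = w i

/-- `|π⁻¹[v₁⋯vₙ]|`: the number of allowable `n`-words of `X` mapped by the one-block map
to the word `v`. -/
noncomputable def preCnt (π : Factor X Y) {n : ℕ} (v : Fin n → B) : ℕ :=
  Nat.card {w : Fin n → A // allowW X w ∧ ∀ i, π.symb (w i) = v i}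

/-- `|D_n(y)|`: the number of length-`n` cylinders of `X` meeting the fiber `π⁻¹(y)`. -/
noncomputable def Dcnt (π : Factor X Y) (n : ℕ) (y : Y.pt) : ℕ :=
  Nat.card {w : Fin n → A // ∃ x : X.pt, π.map x = y ∧ ∀ i : Fin n, x.1 (i : ℕ) = w i}

/-- The relative pressure function `P(σ_X, π, 0)(y) = limsup (1/n) log |D_n(y)|`. -/
noncomputable def relP (π : Factor X Y) (y : Y.pt) : ℝ :=
  Filter.limsup (fun n : ℕ => Real.log (Dcnt π n y) / n) Filter.atTop

/-- The function `y ↦ limsup (1/n) log |π⁻¹[y₁⋯yₙ]|`. -/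
noncomputable def relP' (π : Factor X Y) (y : Y.pt) : ℝ :=
  Filter.limsup (fun n : ℕ => Real.log (preCnt π (fun i : Fin n => y.1 (i : ℕ))) / n)
    Filter.atTop

/-- `h_μ(σ) + ∫ f dμ`, as an extended real number. -/
noncomputable def wtF (X : Subshift A) (f : X.pt → ℝ) (μ : ProbabilityMeasure X.pt) : EReal :=
  (KS X μ : EReal) + ((∫ x, f x ∂μ.toMeasure : ℝ) : EReal)

/-- `lim (1/n) ∫ φ_n dμ` for a subadditive sequence `Φ`; for invariant `μ` the limit exists
in `[-∞, ∞)` and equals the infimum below, by subadditivity. -/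
noncomputable def potLim (X : Subshift A) (Φ : ℕ → X.pt → ℝ)
    (μ : ProbabilityMeasure X.pt) : EReal :=
  ⨅ n : ℕ, (((∫ x, Φ (n + 1) x ∂μ.toMeasure) / (n + 1) : ℝ) : EReal)

/-- `h_μ(σ) + ∫ f dμ + lim (1/n) ∫ φ_n dμ`. -/
noncomputable def wtFP (X : Subshift A) (f : X.pt → ℝ) (Φ : ℕ → X.pt → ℝ)
    (μ : ProbabilityMeasure X.pt) : EReal :=
  wtF X f μ + potLim X Φ μ

/-- `h_μ(σ) + lim (1/n) ∫ φ_n dμ`. -/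
noncomputable def wtP (X : Subshift A) (Φ : ℕ → X.pt → ℝ)
    (μ : ProbabilityMeasure X.pt) : EReal :=
  (KS X μ : EReal) + potLim X Φ μ

/-- `h_μ(σ) - lim (1/n) ∫ φ_n dμ`: the weight of the superadditive potential `-Φ`,
for `Φ` subadditive. -/
noncomputable def wtN (X : Subshift A) (Φ : ℕ → X.pt → ℝ)
    (μ : ProbabilityMeasure X.pt) : EReal :=
  (KS X μ : EReal) - potLim X Φ μ

/-- `M_f(X, σ_X)`: equilibrium states of a bounded Borel measurable function `f`. -/
def eqF (X : Subshift A) (f : X.pt → ℝ) : Set (ProbabilityMeasure X.pt) :=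
  {μ | μ ∈ invP X ∧ wtF X f μ = sSup (wtF X f '' invP X)}

/-- `M_{f+Φ}(X, σ_X)`: equilibrium states of `f + Φ`, `Φ` a subadditive potential. -/
def eqFP (X : Subshift A) (f : X.pt → ℝ) (Φ : ℕ → X.pt → ℝ) :
    Set (ProbabilityMeasure X.pt) :=
  {μ | μ ∈ invP X ∧ wtFP X f Φ μ = sSup (wtFP X f Φ '' invP X)}

/-- `M_Φ(X, σ_X)`: equilibrium states of a subadditive potential `Φ`. -/
def eqP (X : Subshift A) (Φ : ℕ → X.pt → ℝ) : Set (ProbabilityMeasure X.pt) :=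
  {μ | μ ∈ invP X ∧ wtP X Φ μ = sSup (wtP X Φ '' invP X)}

/-- `M_{-Φ}(X, σ_X)`: equilibrium states of `-Φ`, for `Φ` a subadditive potential. -/
def eqN (X : Subshift A) (Φ : ℕ → X.pt → ℝ) : Set (ProbabilityMeasure X.pt) :=
  {μ | μ ∈ invP X ∧ wtN X Φ μ = sSup (wtN X Φ '' invP X)}

/-- `μ` is a measure of maximal relative entropy over `m`. -/
def maxRelOver (π : Factor X Y) (m : ProbabilityMeasure Y.pt)
    (μ : ProbabilityMeasure X.pt) : Prop :=
  μ ∈ invP X ∧ π.push μ = m ∧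
    KS X μ = sSup (KS X '' {ν | ν ∈ invP X ∧ π.push ν = m})

/-- A subadditive potential: a sequence of continuous functions satisfying the
subadditivity condition (`Φ n` is the paper's `φ_n` for `n ≥ 1`). -/
def SubAdd (X : Subshift A) (Φ : ℕ → X.pt → ℝ) : Prop :=
  (∀ n : ℕ, 0 < n → Continuous (Φ n)) ∧
  ∀ n m : ℕ, 0 < n → 0 < m → ∀ x : X.pt, Φ (n + m) x ≤ Φ n x + Φ m (X.σ^[n] x)

/-- An almost additive potential. -/
def AlmostAdd (X : Subshift A) (Φ : ℕ → X.pt → ℝ) : Prop :=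
  (∀ n : ℕ, 0 < n → Continuous (Φ n)) ∧
  ∃ C : ℝ, 0 < C ∧ ∀ n m : ℕ, 0 < n → 0 < m → ∀ x : X.pt,
    -C + Φ n x + Φ m (X.σ^[n] x) ≤ Φ (n + m) x ∧
    Φ (n + m) x ≤ C + Φ n x + Φ m (X.σ^[n] x)

/-- The metric on the sequence space: `d(x,y) = (1/2)^k` where `k` is the first index at
which `x` and `y` differ, and `d(x,y) = 0` if `x = y`. -/
noncomputable def dSeq (x y : ℕ → A) : ℝ :=
  if x = y then 0 else (1 / 2 : ℝ) ^ sInf {n : ℕ | x n ≠ y n}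

/-- An `(n, ε)`-separated (finite) subset of the subshift. -/
def SepSet (Y : Subshift B) (n : ℕ) (ε : ℝ) (E : Finset Y.pt) : Prop :=
  ∀ x ∈ E, ∀ y ∈ E, x ≠ y → ∃ i < n, ε < dSeq ((Y.σ^[i] x) : Y.pt).1 ((Y.σ^[i] y) : Y.pt).1

/-- `P_n(σ_Y, Φ, ε)`: the supremum of `∑_{y ∈ E} exp (φ_n y)` over `(n,ε)`-separated
sets `E`. -/
noncomputable def PnV (Y : Subshift B) (Φ : ℕ → Y.pt → ℝ) (n : ℕ) (ε : ℝ) : ℝ :=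
  sSup {r : ℝ | ∃ E : Finset Y.pt, SepSet Y n ε E ∧ r = ∑ y ∈ E, Real.exp (Φ n y)}

/-- The subadditive topological pressure `P(σ_Y, Φ) = lim_{ε→0} limsup (1/n) log P_n(σ,Φ,ε)`;
since the inner quantity is monotone as `ε` decreases, the limit as `ε → 0⁺` is the
supremum over `ε > 0`. -/
noncomputable def Press (Y : Subshift B) (Φ : ℕ → Y.pt → ℝ) : EReal :=
  ⨆ (ε : ℝ) (_ : 0 < ε),
    Filter.limsup (fun n : ℕ => ((Real.log (PnV Y Φ n ε) / n : ℝ) : EReal)) Filter.atTop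

/-- `X` is a shift of finite type (a 1-step topological Markov shift). -/
def IsSFT (X : Subshift A) : Prop :=
  ∃ Tr : A → A → Prop, X.carrier = {x | ∀ i : ℕ, Tr (x i) (x (i + 1))}

/-- `X` is irreducible: any two allowable words can be joined by some connecting word. -/
def Irr (X : Subshift A) : Prop :=
  ∀ (m n : ℕ) (u : Fin m → A) (v : Fin n → A), allowW X u → allowW X v →
    ∃ (k : ℕ) (w : Fin k → A), allowW X (Fin.append (Fin.append u w) v)

/-- `X` is topologically mixing: any two allowable words can be joined by connecting words
of all sufficiently large lengths. -/
def Mix (X : Subshift A) : Prop :=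
  ∀ (m n : ℕ) (u : Fin m → A) (v : Fin n → A), allowW X u → allowW X v →
    ∃ N : ℕ, ∀ k ≥ N, ∃ w : Fin k → A, allowW X (Fin.append (Fin.append u w) v)

/-- `M` is a mixing gap for the SFT `X`: any two symbols occurring in `X` are joined by an
allowable word of length `M + 1` (this encodes `A^M > 0` for the transition matrix `A`). -/
def MixGap (X : Subshift A) (M : ℕ) : Prop :=
  ∀ a b : A, allowW X (fun _ : Fin 1 => a) → allowW X (fun _ : Fin 1 => b) →
    ∃ w : Fin (M + 1) → A, allowW X w ∧ w 0 = a ∧ w (Fin.last M) = b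

/-- A Gibbs measure for the sequence of potentials `Φ` on the subshift `Y`: there are
`C > 0` and `P` with `1/C < μ[y₁⋯yₙ] / exp(-nP + φ_n(y)) < C` for all `y` and `n ≥ 1`. -/
def IsGibbs (Y : Subshift B) (Φ : ℕ → Y.pt → ℝ) (μ : ProbabilityMeasure Y.pt) : Prop :=
  ∃ C : ℝ, 0 < C ∧ ∃ P : ℝ, ∀ n : ℕ, 0 < n → ∀ y : Y.pt,
    1 / C < (μ.toMeasure (cyl Y (fun i : Fin n => y.1 (i : ℕ)))).toReal /
        Real.exp (-(n : ℝ) * P + Φ n y) ∧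
      (μ.toMeasure (cyl Y (fun i : Fin n => y.1 (i : ℕ)))).toReal /
        Real.exp (-(n : ℝ) * P + Φ n y) < C

/-- A measure is mixing for the map `f`. -/
def MixingM {Ω : Type*} [MeasurableSpace Ω] (f : Ω → Ω) (μ : Measure Ω) : Prop :=
  ∀ s t : Set Ω, MeasurableSet s → MeasurableSet t →
    Filter.Tendsto (fun n : ℕ => (μ (s ∩ f^[n] ⁻¹' t)).toReal) Filter.atTop
      (nhds ((μ s).toReal * (μ t).toReal))

/-- The potential `φ_n(y) = log |π⁻¹[y₁⋯yₙ]|^{1/(α+1)}`. -/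
noncomputable def phiPre (π : Factor X Y) (α : ℝ) (n : ℕ) (y : Y.pt) : ℝ :=
  Real.log (((preCnt π (fun i : Fin n => y.1 (i : ℕ)) : ℝ)) ^ (1 / (α + 1) : ℝ))

/-- The potential `φ'_n(y) = log |D_n(y)|^{1/(α+1)}`. -/
noncomputable def phiD (π : Factor X Y) (α : ℝ) (n : ℕ) (y : Y.pt) : ℝ :=
  Real.log (((Dcnt π n y : ℝ)) ^ (1 / (α + 1) : ℝ))

/-- `S_n = ∑_{v ∈ B_n(Y)} |π⁻¹[v]|^{1/(α+1)}` (non-allowable words contribute `0` since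
then `|π⁻¹[v]| = 0`). -/
noncomputable def Sval (π : Factor X Y) (α : ℝ) (n : ℕ) : ℝ :=
  ∑ v : Fin n → B, ((preCnt π v : ℝ)) ^ (1 / (α + 1) : ℝ)

/-- `M_{-F∘π + Φ∘π}(X, σ_X)` for `F = P(σ_X, π, 0)` and `Φ` a subadditive potential
on `Y`. -/
noncomputable def compEq (π : Factor X Y) (Φ : ℕ → Y.pt → ℝ) :
    Set (ProbabilityMeasure X.pt) :=
  eqFP X (fun x => -relP π (π.map x)) (fun n x => Φ n (π.map x))

/-- The weighted entropy functional `h_μ(σ_X) + α h_{πμ}(σ_Y)`. -/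
noncomputable def wtAlpha (π : Factor X Y) (α : ℝ) (μ : ProbabilityMeasure X.pt) : EReal :=
  (KS X μ : EReal) + (α : EReal) * (KS Y (π.push μ) : EReal)

/-- `K_α`: the set of invariant measures maximizing `h_μ(σ_X) + α h_{πμ}(σ_Y)`. -/
noncomputable def Kalpha (π : Factor X Y) (α : ℝ) : Set (ProbabilityMeasure X.pt) :=
  {μ | μ ∈ invP X ∧ wtAlpha π α μ = sSup (wtAlpha π α '' invP X)}

end Defs

/-! ### The torus, the expanding map `T`, and carpets -/

/-- The two-torus. -/
abbrev T2 : Type := AddCircle (1 : ℝ) × AddCircle (1 : ℝ)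

/-- The endomorphism `T(x, y) = (l x mod 1, m y mod 1)` of the torus. -/
noncomputable def Tmap (l m : ℕ) : T2 → T2 := fun p => (l • p.1, m • p.2)

/-- The coding map `χ` associated to the Markov partition of `T`. -/
noncomputable def chi (l m : ℕ) (x : ℕ → Fin l × Fin m) : T2 :=
  (((∑' k : ℕ, (((x k).1 : ℕ) : ℝ) / l ^ (k + 1) : ℝ) : AddCircle (1:ℝ)),
   ((∑' k : ℕ, (((x k).2 : ℕ) : ℝ) / m ^ (k + 1) : ℝ) : AddCircle (1:ℝ)))

/-- The Hausdorff dimension of a measure: the infimum of the Hausdorff dimensions of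
sets of full measure. -/
noncomputable def dimHMeas {Ω : Type*} [EMetricSpace Ω] [MeasurableSpace Ω]
    (μ : Measure Ω) : ℝ≥0∞ :=
  ⨅ (s : Set Ω) (_ : μ s = 1), dimH s

/-- `μ` is a `T`-invariant ergodic Borel probability measure of full Hausdorff
dimension for the compact invariant set `K`. -/
def FullDimErg (l m : ℕ) (K : Set T2) (μ : Measure T2) : Prop :=
  IsProbabilityMeasure μ ∧ Ergodic (Tmap l m) μ ∧ μ K = 1 ∧ dimHMeas μ = dimH K

/-- The coding map restricted to a carpet subshift. -/
noncomputable def chiPt {l m : ℕ} (X : Subshift (Fin l × Fin m)) (x : X.pt) : T2 :=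
  chi l m x.1

section Helpers

variable {A B : Type*}
  [Fintype A] [TopologicalSpace A] [DiscreteTopology A]
  [MeasurableSpace A] [MeasurableSingletonClass A]
  [Fintype B] [TopologicalSpace B] [DiscreteTopology B]
  [MeasurableSpace B] [MeasurableSingletonClass B]
  {X : Subshift A} {Y : Subshift B}

lemma shiftF_iter (n : ℕ) (x : ℕ → A) (i : ℕ) : ((shiftF A)^[n] x) i = x (i + n) := by
  induction n generalizing x i with
  | zero => rfl
  | succ n ih =>
    rw [Function.iterate_succ_apply, ih]
    simp only [shiftF]
    congr 1

lemma shift_iter_mem (X : Subshift A) (n : ℕ) (x : ℕ → A) (hx : x ∈ X.carrier) :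
    (fun i => x (i + n)) ∈ X.carrier := by
  have h : ∀ n, (shiftF A)^[n] x ∈ X.carrier := by
    intro n
    induction n with
    | zero => exact hx
    | succ n ih => rw [Function.iterate_succ_apply']; exact X.shift_mem _ ih
  have := h n
  convert this using 1
  funext i
  rw [shiftF_iter]

lemma sigma_iter_val (Y : Subshift B) (n : ℕ) (y : Y.pt) (i : ℕ) :
    (Y.σ^[n] y).1 i = y.1 (i + n) := by
  induction n generalizing y i with
  | zero => rfl
  | succ n ih =>
    rw [Function.iterate_succ_apply, ih]
    simp only [Subshift.σ, shiftF]
    congr 1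

lemma allow_left {m n : ℕ} {u : Fin m → A} {v : Fin n → A} (h : allowW X (Fin.append u v)) :
    allowW X u := by
  obtain ⟨x, hx, hxi⟩ := h
  refine ⟨x, hx, fun i => ?_⟩
  have := hxi (Fin.castAdd n i)
  simpa using this

lemma allow_right {m n : ℕ} {u : Fin m → A} {v : Fin n → A} (h : allowW X (Fin.append u v)) :
    allowW X v := by
  obtain ⟨x, hx, hxi⟩ := h
  refine ⟨_, shift_iter_mem X m x hx, fun i => ?_⟩
  have := hxi (Fin.natAdd m i)
  simp only [Fin.append_right, Fin.val_natAdd] at this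
  rw [← this, add_comm]

lemma preCnt_cast (π : Factor X Y) {m n : ℕ} (h : m = n) (v : Fin n → B) :
    preCnt π (v ∘ Fin.cast h) = preCnt π v := by
  subst h; rfl

lemma append_symb {m n : ℕ} (f : A → B) (a : Fin m → A) (b : Fin n → A) (u : Fin m → B)
    (v : Fin n → B) (h : ∀ i, f (Fin.append a b i) = Fin.append u v i) :
    (∀ i, f (a i) = u i) ∧ ∀ i, f (b i) = v i :=
  ⟨fun i => by simpa using h (Fin.castAdd n i), fun i => by simpa using h (Fin.natAdd m i)⟩

lemma preCnt_append_le (π : Factor X Y) {m n : ℕ} (u : Fin m → B) (v : Fin n → B) :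
    preCnt π (Fin.append u v) ≤ preCnt π u * preCnt π v := by
  unfold preCnt
  rw [← Nat.card_prod]
  have key : ∀ w : {w : Fin (m + n) → A // allowW X w ∧ ∀ i, π.symb (w i) = Fin.append u v i},
      ∃ p : {w : Fin m → A // allowW X w ∧ ∀ i, π.symb (w i) = u i} ×
        {w : Fin n → A // allowW X w ∧ ∀ i, π.symb (w i) = v i},
        Fin.append p.1.1 p.2.1 = w.1 := by
    rintro ⟨w, hw, hs⟩
    obtain ⟨⟨a, b⟩, rfl⟩ := (Fin.appendEquiv m n).surjective w
    have h2 := append_symb π.symb a b u v hs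
    exact ⟨(⟨a, allow_left hw, h2.1⟩, ⟨b, allow_right hw, h2.2⟩), rfl⟩
  choose f hf using key
  refine Nat.card_le_card_of_injective f ?_
  intro w ww h
  apply Subtype.ext
  rw [← hf w, ← hf ww, h]

lemma connect (hXS : IsSFT X) (k : ℕ) (hM : MixGap X (k + 1)) {m n : ℕ} (hm : 0 < m) (hn : 0 < n)
    (a : Fin m → A) (b : Fin n → A) (ha : allowW X a) (hb : allowW X b) :
    ∃ c : Fin k → A, allowW X (Fin.append (Fin.append a c) b) := by
  obtain ⟨Tr, hTr⟩ := hXS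
  obtain ⟨x, hx, hxa⟩ := ha
  obtain ⟨y, hy, hyb⟩ := hb
  obtain ⟨m, rfl⟩ : ∃ mm, m = mm + 1 := ⟨m - 1, by omega⟩
  obtain ⟨w, ⟨z, hz, hzw⟩, hw0, hw1⟩ := hM (x m) (y 0)
    ⟨_, shift_iter_mem X m x hx, fun i => by
      have : (i : ℕ) = 0 := by omega
      simp [this]⟩
    ⟨y, hy, fun i => by
      have : (i : ℕ) = 0 := by omega
      simp [this]⟩
  have hz0 : z 0 = x m := by rw [← hw0, ← hzw]; rfl
  have hz1 : z (k + 1) = y 0 := by rw [← hw1, ← hzw]; rfl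
  rw [hTr] at hx hy hz
  change ∀ i, _ at hx hy hz
  refine ⟨fun i => z (i + 1), fun i => if i < m then x i else if i < m + (k + 1) then z (i - m)
    else y (i - (m + (k + 1))), ?_, ?_⟩
  · rw [hTr]
    intro i
    dsimp only
    by_cases h1 : i + 1 < m
    · rw [if_pos (by omega), if_pos h1]; exact hx i
    by_cases h2 : i + 1 = m
    · rw [if_pos (by omega), if_neg h1, if_pos (by omega)]
      have : i + 1 - m = 0 := by omega
      rw [this, hz0, ← h2]; exact hx i
    rw [if_neg (by omega), if_neg h1]
    by_cases h3 : i + 1 < m + (k + 1)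
    · rw [if_pos (by omega), if_pos h3]
      have : i + 1 - m = (i - m) + 1 := by omega
      rw [this]; exact hz _
    by_cases h4 : i + 1 = m + (k + 1)
    · rw [if_pos (by omega), if_neg h3]
      have e1 : i + 1 - (m + (k + 1)) = 0 := by omega
      have e2 : i - m = k := by omega
      rw [e1, e2, ← hz1]; exact hz k
    · rw [if_neg (by omega), if_neg h3]
      have : i + 1 - (m + (k + 1)) = (i - (m + (k + 1))) + 1 := by omega
      rw [this]; exact hy _
  · intro i
    refine Fin.addCases (fun i => ?_) (fun i => ?_) i
    · refine Fin.addCases (fun i => ?_) (fun i => ?_) i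
      · simp only [Fin.append_left, Fin.val_castAdd]
        rw [← hxa]
        have hi := i.2
        by_cases h : (i : ℕ) < m
        · rw [if_pos h]
        · have : (i : ℕ) = m := by omega
          rw [if_neg h, if_pos (by omega), this, Nat.sub_self, hz0]
      · simp only [Fin.append_left, Fin.append_right, Fin.val_castAdd, Fin.val_natAdd]
        have hi := i.2
        rw [if_neg (by omega), if_pos (by omega)]
        congr 1
        omega
    · simp only [Fin.append_right, Fin.val_natAdd]
      rw [if_neg (by omega), if_neg (by omega), ← hyb]
      congr 1
      omega

lemma preCnt_gap (hXS : IsSFT X) (k : ℕ) (hM : MixGap X (k + 1)) (π : Factor X Y) {m n : ℕ}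
    (hm : 0 < m) (hn : 0 < n) (u : Fin m → B) (v : Fin n → B) :
    preCnt π u * preCnt π v ≤ ∑ w : Fin k → B, preCnt π (Fin.append (Fin.append u w) v) := by
  have e : ∑ w : Fin k → B, preCnt π (Fin.append (Fin.append u w) v) =
      Nat.card (Σ w : Fin k → B, {x : Fin (m + k + n) → A // allowW X x ∧
        ∀ i, π.symb (x i) = Fin.append (Fin.append u w) v i}) := by
    rw [Nat.card_sigma]; rfl
  rw [e]
  unfold preCnt
  rw [← Nat.card_prod]
  have key : ∀ p : {w : Fin m → A // allowW X w ∧ ∀ i, π.symb (w i) = u i} ×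
        {w : Fin n → A // allowW X w ∧ ∀ i, π.symb (w i) = v i},
      ∃ r : (Σ w : Fin k → B, {x : Fin (m + k + n) → A // allowW X x ∧
        ∀ i, π.symb (x i) = Fin.append (Fin.append u w) v i}),
        ∃ c, r.2.1 = Fin.append (Fin.append p.1.1 c) p.2.1 := by
    rintro ⟨⟨a, ha, hau⟩, ⟨b, hb, hbv⟩⟩
    obtain ⟨c, hc⟩ := connect hXS k hM hm hn a b ha hb
    refine ⟨⟨fun i => π.symb (c i), ⟨_, hc, fun i => ?_⟩⟩, c, rfl⟩
    refine Fin.addCases (fun i => ?_) (fun i => ?_) i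
    · refine Fin.addCases (fun i => ?_) (fun i => ?_) i
      · simp [hau]
      · simp
    · simp [hbv]
  choose f c hf using key
  refine Nat.card_le_card_of_injective f ?_
  intro p pp h
  have h1 : Fin.append (Fin.append p.1.1 (c p)) p.2.1 =
      Fin.append (Fin.append pp.1.1 (c pp)) pp.2.1 := by
    rw [← hf p, ← hf pp, h]
  have h2 := (Fin.appendEquiv (m + k) n).injective
    (a₁ := (Fin.append p.1.1 (c p), p.2.1)) (a₂ := (Fin.append pp.1.1 (c pp), pp.2.1)) h1
  have h3 := (Fin.appendEquiv m k).injective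
    (a₁ := (p.1.1, c p)) (a₂ := (pp.1.1, c pp)) (congrArg Prod.fst h2)
  exact Prod.ext (Subtype.ext (congrArg Prod.fst h3)) (Subtype.ext (congrArg Prod.snd h2))

lemma mixGap_succ (h : MixGap X 0) : MixGap X 1 := by
  have hab : ∀ a b : A, allowW X (fun _ : Fin 1 => a) → allowW X (fun _ : Fin 1 => b) → a = b := by
    intro a b ha hb
    obtain ⟨w, -, h0, h1⟩ := h a b ha hb
    rw [← h0, ← h1]; rfl
  intro a b ha hb
  obtain ⟨x, hx, hxa⟩ := ha
  refine ⟨fun i => x i, ⟨x, hx, fun i => rfl⟩, hxa 0, ?_⟩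
  refine hab _ _ ⟨_, shift_iter_mem X 1 x hx, fun i => ?_⟩ hb
  have : (i : ℕ) = 0 := by omega
  simp [this]

lemma preCnt_pos (π : Factor X Y) {n : ℕ} (v : Fin n → B) (hv : allowW Y v) :
    0 < preCnt π v := by
  obtain ⟨y, hy, hyv⟩ := hv
  obtain ⟨x, hx, rfl⟩ := π.surj y hy
  haveI : Nonempty {w : Fin n → A // allowW X w ∧ ∀ i, π.symb (w i) = v i} :=
    ⟨⟨fun i => x i, ⟨x, hx, fun _ => rfl⟩, hyv⟩⟩
  exact Nat.card_pos

lemma rpow_sum_le {ι : Type*} (s : Finset ι) (f : ι → ℕ) {q : ℝ} (h0 : 0 < q) (h1 : q ≤ 1) :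
    ((∑ i ∈ s, f i : ℕ) : ℝ) ^ q ≤ ∑ i ∈ s, (f i : ℝ) ^ q := by
  have := Finset.le_sum_of_subadditive (fun x : ℝ≥0 => x ^ q) (by simp [h0.ne'])
    (fun x y => NNReal.rpow_add_le_add_rpow x y h0.le h1) s (fun i => (f i : ℝ≥0))
  have h2 := NNReal.coe_le_coe.2 this
  push_cast at h2 ⊢
  exact h2

/-- weight of a word -/
noncomputable def wt (π : Factor X Y) (α : ℝ) {n : ℕ} (v : Fin n → B) : ℝ :=
  (preCnt π v : ℝ) ^ (1 / (α + 1) : ℝ)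

lemma wt_nonneg (π : Factor X Y) (α : ℝ) {n : ℕ} (v : Fin n → B) : 0 ≤ wt π α v := by
  unfold wt; positivity

lemma wt_append_le (π : Factor X Y) {α : ℝ} (hα : 0 < α) {m n : ℕ} (u : Fin m → B)
    (v : Fin n → B) : wt π α (Fin.append u v) ≤ wt π α u * wt π α v := by
  unfold wt
  rw [← Real.mul_rpow (by positivity) (by positivity)]
  apply Real.rpow_le_rpow (by positivity) _ (by positivity)
  exact_mod_cast preCnt_append_le π u v

lemma wt_gap (hXS : IsSFT X) (k : ℕ) (hM : MixGap X (k + 1)) (π : Factor X Y) {α : ℝ} (hα : 0 < α)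
    {m n : ℕ} (hm : 0 < m) (hn : 0 < n) (u : Fin m → B) (v : Fin n → B) :
    wt π α u * wt π α v ≤ ∑ w : Fin k → B, wt π α (Fin.append (Fin.append u w) v) := by
  unfold wt
  rw [← Real.mul_rpow (by positivity) (by positivity)]
  refine le_trans ?_ (rpow_sum_le _ _ (by positivity) ?_)
  · apply Real.rpow_le_rpow (by positivity) _ (by positivity)
    exact_mod_cast preCnt_gap hXS k hM π hm hn u v
  · rw [div_le_one (by positivity)]; linarith

lemma wt_gapp (hXS : IsSFT X) (k : ℕ) (hM : MixGap X (k + 1)) (π : Factor X Y) {α : ℝ}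
    (hα : 0 < α) {m n : ℕ} (hm : 0 < m) (hn : 0 < n) (u : Fin m → B) (v : Fin n → B) :
    wt π α u * wt π α v ≤ ∑ w : Fin k → B, wt π α (Fin.append u (Fin.append w v)) := by
  refine (wt_gap hXS k hM π hα hm hn u v).trans (le_of_eq (Finset.sum_congr rfl fun w _ => ?_))
  unfold wt
  rw [Fin.append_assoc, preCnt_cast]

lemma sum_append {m n : ℕ} (f : (Fin (m + n) → B) → ℝ) :
    ∑ w, f w = ∑ u : Fin m → B, ∑ v : Fin n → B, f (Fin.append u v) := by
  rw [← (Fin.appendEquiv m n).sum_comp, Fintype.sum_prod_type]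
  rfl

lemma Sval_add_le (π : Factor X Y) {α : ℝ} (hα : 0 < α) (m n : ℕ) :
    Sval π α (m + n) ≤ Sval π α m * Sval π α n := by
  unfold Sval
  rw [sum_append, Finset.sum_mul_sum]
  exact Finset.sum_le_sum fun u _ => Finset.sum_le_sum fun v _ => wt_append_le π hα u v

lemma sum_wt_left (hXS : IsSFT X) (k : ℕ) (hM : MixGap X (k + 1)) (π : Factor X Y) {α : ℝ}
    (hα : 0 < α) {m n : ℕ} (hm : 0 < m) (hn : 0 < n) (v : Fin n → B) :
    Sval π α m * wt π α v ≤ ∑ u : Fin (m + k) → B, wt π α (Fin.append u v) := by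
  rw [sum_append]
  unfold Sval
  rw [Finset.sum_mul]
  exact Finset.sum_le_sum fun u _ => wt_gap hXS k hM π hα hm hn u v

lemma sum_wt_right (hXS : IsSFT X) (k : ℕ) (hM : MixGap X (k + 1)) (π : Factor X Y) {α : ℝ}
    (hα : 0 < α) {m n : ℕ} (hm : 0 < m) (hn : 0 < n) (v : Fin n → B) :
    wt π α v * Sval π α m ≤ ∑ u : Fin (k + m) → B, wt π α (Fin.append v u) := by
  rw [sum_append, Finset.sum_comm]
  unfold Sval
  rw [Finset.mul_sum]
  exact Finset.sum_le_sum fun u _ => wt_gapp hXS k hM π hα hn hm v u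

lemma sum_wt_left_le (π : Factor X Y) {α : ℝ}
    (hα : 0 < α) {m n : ℕ} (v : Fin n → B) :
    ∑ u : Fin m → B, wt π α (Fin.append u v) ≤ Sval π α m * wt π α v := by
  unfold Sval
  rw [Finset.sum_mul]
  exact Finset.sum_le_sum fun u _ => wt_append_le π hα u v

lemma sum_wt_right_le (π : Factor X Y) {α : ℝ}
    (hα : 0 < α) {m n : ℕ} (v : Fin n → B) :
    ∑ u : Fin m → B, wt π α (Fin.append v u) ≤ wt π α v * Sval π α m := by
  unfold Sval
  rw [Finset.mul_sum]
  exact Finset.sum_le_sum fun u _ => wt_append_le π hα v u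

lemma Sval_gap (hXS : IsSFT X) (k : ℕ) (hM : MixGap X (k + 1)) (π : Factor X Y) {α : ℝ}
    (hα : 0 < α) {m n : ℕ} (hm : 0 < m) (hn : 0 < n) :
    Sval π α m * Sval π α n ≤ Sval π α k * Sval π α (m + n) := by
  have h1 : Sval π α m * Sval π α n ≤ Sval π α (m + k + n) := by
    have e : Sval π α (m + k + n) =
        ∑ v : Fin n → B, ∑ u : Fin (m + k) → B, wt π α (Fin.append u v) := by
      rw [Finset.sum_comm]; exact sum_append _
    rw [e]
    conv_lhs => rw [Sval.eq_def π α n, Finset.mul_sum]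
    exact Finset.sum_le_sum fun v _ => sum_wt_left hXS k hM π hα hm hn v
  have e : m + k + n = k + (m + n) := by ring
  rw [e] at h1
  exact h1.trans (Sval_add_le π hα _ _)

lemma Sval_pos (π : Factor X Y) (α : ℝ) (y : Y.pt) (n : ℕ) : 0 < Sval π α n := by
  unfold Sval
  refine lt_of_lt_of_le (b := wt π α (fun i : Fin n => y.1 i)) ?_
    (Finset.single_le_sum (f := fun v : Fin n → B => wt π α v)
    (fun v _ => wt_nonneg π α v) (Finset.mem_univ _))
  exact Real.rpow_pos_of_pos (Nat.cast_pos.2 (preCnt_pos π _ ⟨y.1, y.2, fun _ => rfl⟩)) _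

lemma subadd_bound (a : ℕ → ℝ) (ha : ∀ m n, 0 < m → 0 < n → a (m + n) ≤ a m + a n) (P : ℝ)
    (hP : Tendsto (fun n : ℕ => a n / n) atTop (𝓝 P)) (n : ℕ) (hn : 0 < n) : n * P ≤ a n := by
  have h1 : ∀ j : ℕ, a ((j + 1) * n) ≤ (j + 1) * a n := by
    intro j
    induction j with
    | zero => simp
    | succ j ih =>
      have := ha ((j + 1) * n) n (by positivity) hn
      have e : (j + 1 + 1) * n = (j + 1) * n + n := by ring
      rw [e]
      push_cast
      linarith
  have h2 : Tendsto (fun j : ℕ => (j + 1) * n) atTop atTop :=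
    tendsto_atTop_mono (fun j => by simp only [id]; nlinarith) tendsto_id
  have h3 := hP.comp h2
  have h4 : P ≤ a n / n := by
    refine le_of_tendsto h3 (Eventually.of_forall fun j => ?_)
    have hn' : (0 : ℝ) < n := by exact_mod_cast hn
    simp only [Function.comp]
    push_cast
    rw [div_le_div_iff₀ (by positivity) hn']
    have := mul_le_mul_of_nonneg_right (h1 j) hn'.le
    linarith
  have hn' : (0 : ℝ) < n := by exact_mod_cast hn
  rw [le_div_iff₀ hn'] at h4
  linarith

lemma Sval_bounds (hXS : IsSFT X) (k : ℕ) (hM : MixGap X (k + 1)) (π : Factor X Y) {α : ℝ}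
    (hα : 0 < α) (y : Y.pt) (P : ℝ)
    (hP : Tendsto (fun n : ℕ => Real.log (Sval π α n) / n) atTop (𝓝 P)) (n : ℕ) (hn : 0 < n) :
    Real.exp (n * P) ≤ Sval π α n ∧ Sval π α n ≤ Sval π α k * Real.exp (n * P) := by
  have pos := Sval_pos π α y
  constructor
  · rw [← Real.le_log_iff_exp_le (pos n)]
    refine subadd_bound _ (fun m n _ _ => ?_) P hP n hn
    rw [← Real.log_mul (pos _).ne' (pos _).ne']
    exact Real.log_le_log (pos _) (Sval_add_le π hα m n)
  · have := subadd_bound (fun n => Real.log (Sval π α k) - Real.log (Sval π α n))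
      (fun m n hm hn => by
        have h := Real.log_le_log (mul_pos (pos _) (pos _)) (Sval_gap hXS k hM π hα hm hn)
        rw [Real.log_mul (pos _).ne' (pos _).ne', Real.log_mul (pos _).ne' (pos _).ne'] at h
        linarith) (-P) (by
        have h := (tendsto_const_div_atTop_nhds_zero_nat (Real.log (Sval π α k))).sub hP
        rw [zero_sub] at h
        refine h.congr fun n => ?_
        rw [sub_div]) n hn
    rw [← Real.log_le_log_iff (pos _) (mul_pos (pos _) (Real.exp_pos _)),
      Real.log_mul (pos _).ne' (Real.exp_pos _).ne', Real.log_exp]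
    linarith

lemma isClopen_cyl (Y : Subshift B) {n : ℕ} (v : Fin n → B) : IsClopen (cyl Y v) := by
  have : cyl Y v = ⋂ i : Fin n, (fun y : Y.pt => y.1 (i : ℕ)) ⁻¹' {v i} := by
    ext y; simp [cyl]
  rw [this]
  refine isClopen_iInter_of_finite fun i => ?_
  exact (isClopen_discrete _).preimage ((continuous_apply _).comp continuous_subtype_val)

lemma measurableSet_cyl (Y : Subshift B) {n : ℕ} (v : Fin n → B) : MeasurableSet (cyl Y v) :=
  (isClopen_cyl Y v).1.measurableSet

lemma continuous_sigma (Y : Subshift B) : Continuous Y.σ := by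
  unfold Subshift.σ
  refine Continuous.subtype_mk (continuous_pi fun i => ?_) _
  exact (continuous_apply (i + 1)).comp continuous_subtype_val

lemma measurable_sigma (Y : Subshift B) : Measurable Y.σ := by
  unfold Subshift.σ
  refine Measurable.subtype_mk (measurable_pi_lambda _ fun i => ?_)
  exact (measurable_pi_apply (i + 1)).comp measurable_subtype_coe

lemma measurable_sigma_iter (Y : Subshift B) (i : ℕ) : Measurable (Y.σ^[i]) :=
  (measurable_sigma Y).iterate i

lemma cyl_append (Y : Subshift B) {m n : ℕ} (u : Fin m → B) (v : Fin n → B) :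
    cyl Y (Fin.append u v) = cyl Y u ∩ Y.σ^[m] ⁻¹' cyl Y v := by
  ext y
  simp only [cyl, Set.mem_inter_iff, Set.mem_preimage]
  constructor
  · intro h
    refine ⟨fun i => ?_, fun i => ?_⟩
    · simpa using h (Fin.castAdd n i)
    · have := h (Fin.natAdd m i)
      rw [sigma_iter_val, add_comm]
      simpa using this
  · rintro ⟨h1, h2⟩ i
    refine Fin.addCases (fun i => ?_) (fun i => ?_) i
    · simpa using h1 i
    · have := h2 i
      rw [sigma_iter_val, add_comm] at this
      simpa using this

lemma cyl_disj (Y : Subshift B) {n : ℕ} {u v : Fin n → B} (h : u ≠ v) :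
    Disjoint (cyl Y u) (cyl Y v) := by
  rw [Set.disjoint_left]
  intro y hu hv
  exact h (funext fun i => (hu i).symm.trans (hv i))

lemma mem_cyl_self (Y : Subshift B) (n : ℕ) (y : Y.pt) : y ∈ cyl Y (fun i : Fin n => y.1 i) :=
  fun _ => rfl

lemma real_cyl_right (Y : Subshift B) (μ : Measure Y.pt) [IsProbabilityMeasure μ] (m : ℕ) {n : ℕ}
    (v : Fin n → B) : μ.real (cyl Y v) = ∑ w : Fin m → B, μ.real (cyl Y (Fin.append v w)) := by
  rw [← measureReal_biUnion_finset]
  · congr 1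
    ext y
    simp only [cyl_append, Set.mem_iUnion, Finset.mem_univ, exists_true_left, Set.mem_inter_iff]
    exact ⟨fun h => ⟨_, h, mem_cyl_self Y m _⟩, fun ⟨_, h, _⟩ => h⟩
  · intro u _ w _ h
    simp only [Function.onFun, cyl_append]
    exact Disjoint.mono inter_subset_right inter_subset_right ((cyl_disj Y h).preimage _)
  · exact fun _ _ => measurableSet_cyl _ _

lemma real_cyl_left (Y : Subshift B) (μ : Measure Y.pt) [IsProbabilityMeasure μ] (m : ℕ) {n : ℕ}
    (v : Fin n → B) :
    μ.real (Y.σ^[m] ⁻¹' cyl Y v) = ∑ w : Fin m → B, μ.real (cyl Y (Fin.append w v)) := by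
  rw [← measureReal_biUnion_finset]
  · congr 1
    ext y
    simp only [cyl_append, Set.mem_iUnion, Finset.mem_univ, exists_true_left, Set.mem_inter_iff]
    exact ⟨fun h => ⟨_, mem_cyl_self Y m _, h⟩, fun ⟨_, _, h⟩ => h⟩
  · intro u _ w _ h
    simp only [Function.onFun, cyl_append]
    exact Disjoint.mono inter_subset_left inter_subset_left (cyl_disj Y h)
  · exact fun _ _ => measurableSet_cyl _ _

lemma tendsto_real_clopen (Y : Subshift B) {f : ℕ → ProbabilityMeasure Y.pt}
    {μ : ProbabilityMeasure Y.pt} (h : Tendsto f atTop (𝓝 μ)) {E : Set Y.pt} (hE : IsClopen E) :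
    Tendsto (fun j => (f j).toMeasure.real E) atTop (𝓝 (μ.toMeasure.real E)) := by
  have := ProbabilityMeasure.tendsto_measure_of_isClopen_of_tendsto h hE
  exact (NNReal.tendsto_coe.2 this)

lemma ext_cyl (Y : Subshift B) (μ ν : Measure Y.pt) [IsProbabilityMeasure μ]
    [IsProbabilityMeasure ν]
    (h : ∀ (n : ℕ) (v : Fin n → B), μ.real (cyl Y v) = ν.real (cyl Y v)) : μ = ν := by
  refine ext_of_generate_finite {s | ∃ (n : ℕ) (v : Fin n → B), s = cyl Y v} ?_ ?_ ?_ (by simp)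
  · apply le_antisymm
    · change MeasurableSpace.comap _ (⨆ i, MeasurableSpace.comap _ _) ≤ _
      rw [MeasurableSpace.comap_iSup]
      refine iSup_le fun i => ?_
      rw [MeasurableSpace.comap_comp]
      rintro s ⟨t, -, rfl⟩
      have e : ((fun b : ℕ → B => b i) ∘ Subtype.val) ⁻¹' t =
          ⋃ v ∈ {v : Fin (i + 1) → B | v (Fin.last i) ∈ t}, cyl Y v := by
        ext y
        simp only [Set.mem_iUnion, Set.mem_preimage, Function.comp]
        constructor
        · intro hy
          exact ⟨fun j => y.1 j, hy, mem_cyl_self Y _ y⟩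
        · rintro ⟨v, hv, hy⟩
          have := hy (Fin.last i)
          simp only [Fin.val_last] at this
          rw [this]; exact hv
      rw [e]
      refine MeasurableSet.biUnion (Set.to_countable _) fun v _ => ?_
      exact MeasurableSpace.measurableSet_generateFrom ⟨_, v, rfl⟩
    · refine MeasurableSpace.generateFrom_le ?_
      rintro s ⟨n, v, rfl⟩
      exact measurableSet_cyl Y v
  · have key : ∀ (n m : ℕ) (_ : n ≤ m) (u : Fin n → B) (v : Fin m → B),
        (cyl Y u ∩ cyl Y v).Nonempty → cyl Y u ∩ cyl Y v = cyl Y v := by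
      rintro n m hnm u v ⟨y, hu, hv⟩
      apply Set.inter_eq_right.2
      intro z hz i
      rw [← hu i]
      exact (hz ⟨i, by omega⟩).trans (hv ⟨i, by omega⟩).symm
    rintro _ ⟨n, u, rfl⟩ _ ⟨m, v, rfl⟩ hne
    rcases le_total n m with hnm | hnm
    · exact ⟨m, v, key n m hnm u v hne⟩
    · rw [Set.inter_comm] at hne ⊢
      exact ⟨n, u, key m n hnm v u hne⟩
  · rintro _ ⟨n, v, rfl⟩
    exact (measureReal_eq_measureReal_iff).1 (h n v)

lemma nu_bounds (hXS : IsSFT X) (k : ℕ) (hM : MixGap X (k + 1)) (π : Factor X Y) {α : ℝ}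
    (hα : 0 < α) (y : Y.pt) (P : ℝ)
    (hP : Tendsto (fun n : ℕ => Real.log (Sval π α n) / n) atTop (𝓝 P))
    (νseq : ℕ → ProbabilityMeasure Y.pt)
    (hν : ∀ n : ℕ, 0 < n → ∀ v : Fin n → B,
      (νseq n).toMeasure.real (cyl Y v) = wt π α v / Sval π α n)
    (s : ℕ → ℕ) (hs : StrictMono s) (ν : ProbabilityMeasure Y.pt)
    (hconv : Tendsto (fun j => νseq (s j)) atTop (𝓝 ν)) (n : ℕ) (hn : 0 < n) (v : Fin n → B) :
    wt π α v / (Sval π α k * Real.exp ((n + k : ℕ) * P)) ≤ ν.toMeasure.real (cyl Y v) ∧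
    ν.toMeasure.real (cyl Y v) ≤ wt π α v * Sval π α k / Real.exp (n * P) := by
  have pos := Sval_pos π α y
  have hb := Sval_bounds hXS k hM π hα y P hP
  have hlim := tendsto_real_clopen Y hconv (isClopen_cyl Y v)
  have hw := wt_nonneg π α v
  constructor
  · refine ge_of_tendsto hlim ?_
    filter_upwards [hs.tendsto_atTop.eventually_ge_atTop (n + k + 1)] with j hj
    obtain ⟨m, hm⟩ : ∃ m, s j = n + (k + (m + 1)) := ⟨s j - (n + k + 1), by omega⟩
    rw [hm, real_cyl_right Y _ (k + (m + 1)) v]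
    simp_rw [hν (n + (k + (m + 1))) (by omega)]
    rw [← Finset.sum_div, div_le_div_iff₀ (mul_pos (pos _) (Real.exp_pos _)) (pos _)]
    have h1 := sum_wt_right hXS k hM π hα (Nat.succ_pos m) hn v
    have h2 : Sval π α (n + (k + (m + 1))) ≤ Sval π α (n + k) * Sval π α (m + 1) := by
      rw [← add_assoc]; exact Sval_add_le π hα _ _
    have h3 := (hb (n + k) (by omega)).2
    calc wt π α v * Sval π α (n + (k + (m + 1)))
        ≤ wt π α v * ((Sval π α k * Real.exp ((n + k : ℕ) * P)) * Sval π α (m + 1)) := by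
          refine mul_le_mul_of_nonneg_left (h2.trans ?_) hw
          exact mul_le_mul_of_nonneg_right h3 (pos _).le
      _ = (wt π α v * Sval π α (m + 1)) * (Sval π α k * Real.exp ((n + k : ℕ) * P)) := by ring
      _ ≤ _ := mul_le_mul_of_nonneg_right h1 (mul_pos (pos _) (Real.exp_pos _)).le
  · refine le_of_tendsto hlim ?_
    filter_upwards [hs.tendsto_atTop.eventually_ge_atTop (n + 1)] with j hj
    obtain ⟨m, hm⟩ : ∃ m, s j = n + (m + 1) := ⟨s j - (n + 1), by omega⟩
    rw [hm, real_cyl_right Y _ (m + 1) v]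
    simp_rw [hν (n + (m + 1)) (by omega)]
    rw [← Finset.sum_div, div_le_div_iff₀ (pos _) (Real.exp_pos _)]
    have h1 := sum_wt_right_le π hα (m := m + 1) v
    have h2 := Sval_gap hXS k hM π hα hn (Nat.succ_pos m)
    have h3 := (hb n hn).1
    calc (∑ u : Fin (m + 1) → B, wt π α (Fin.append v u)) * Real.exp (n * P)
        ≤ (wt π α v * Sval π α (m + 1)) * Sval π α n :=
          mul_le_mul h1 h3 (Real.exp_pos _).le (mul_nonneg hw (pos _).le)
      _ = wt π α v * (Sval π α n * Sval π α (m + 1)) := by ring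
      _ ≤ wt π α v * (Sval π α k * Sval π α (n + (m + 1))) := mul_le_mul_of_nonneg_left h2 hw
      _ = _ := by ring

lemma shift_upper (hXS : IsSFT X) (k : ℕ) (hM : MixGap X (k + 1)) (π : Factor X Y) {α : ℝ}
    (hα : 0 < α) (y : Y.pt) (P : ℝ)
    (hP : Tendsto (fun n : ℕ => Real.log (Sval π α n) / n) atTop (𝓝 P))
    (ν : ProbabilityMeasure Y.pt)
    (hν : ∀ n : ℕ, 0 < n → ∀ v : Fin n → B,
      ν.toMeasure.real (cyl Y v) ≤ wt π α v * Sval π α k / Real.exp (n * P))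
    (n : ℕ) (hn : 0 < n) (v : Fin n → B) (i : ℕ) (hi : 0 < i) :
    ν.toMeasure.real (Y.σ^[i] ⁻¹' cyl Y v) ≤
      Sval π α k ^ 2 * (Real.exp (-(n : ℝ) * P) * wt π α v) := by
  have pos := Sval_pos π α y
  have hb := Sval_bounds hXS k hM π hα y P hP
  have hw := wt_nonneg π α v
  rw [real_cyl_left]
  calc ∑ w : Fin i → B, ν.toMeasure.real (cyl Y (Fin.append w v))
      ≤ ∑ w : Fin i → B, wt π α (Fin.append w v) *
          (Sval π α k / Real.exp ((i + n : ℕ) * P)) := by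
        refine Finset.sum_le_sum fun w _ => ?_
        rw [← mul_div_assoc]
        exact hν (i + n) (by omega) _
    _ = (∑ w : Fin i → B, wt π α (Fin.append w v)) *
          (Sval π α k / Real.exp ((i + n : ℕ) * P)) := by rw [Finset.sum_mul]
    _ ≤ ((Sval π α k * Real.exp (i * P)) * wt π α v) *
          (Sval π α k / Real.exp ((i + n : ℕ) * P)) := by
        refine mul_le_mul_of_nonneg_right ?_ (div_pos (pos _) (Real.exp_pos _)).le
        exact (sum_wt_left_le π hα v).trans (mul_le_mul_of_nonneg_right (hb i hi).2 hw)
    _ = _ := by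
        push_cast
        rw [add_mul, Real.exp_add, neg_mul, Real.exp_neg]
        have := (Real.exp_pos (i * P)).ne'
        have := (Real.exp_pos (n * P)).ne'
        field_simp

lemma shift_lower (hXS : IsSFT X) (k : ℕ) (hM : MixGap X (k + 1)) (π : Factor X Y) {α : ℝ}
    (hα : 0 < α) (y : Y.pt) (P : ℝ)
    (hP : Tendsto (fun n : ℕ => Real.log (Sval π α n) / n) atTop (𝓝 P))
    (ν : ProbabilityMeasure Y.pt)
    (hν : ∀ n : ℕ, 0 < n → ∀ v : Fin n → B,
      wt π α v / (Sval π α k * Real.exp ((n + k : ℕ) * P)) ≤ ν.toMeasure.real (cyl Y v))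
    (n : ℕ) (hn : 0 < n) (v : Fin n → B) (i : ℕ) (hi : 0 < i) :
    (Sval π α k * Real.exp (k * P) * Real.exp (k * P))⁻¹ *
      (Real.exp (-(n : ℝ) * P) * wt π α v) ≤
      ν.toMeasure.real (Y.σ^[i + k] ⁻¹' cyl Y v) := by
  have pos := Sval_pos π α y
  have hb := Sval_bounds hXS k hM π hα y P hP
  have hw := wt_nonneg π α v
  rw [real_cyl_left]
  calc _ = (Real.exp (i * P) * wt π α v) *
          (Sval π α k * Real.exp ((i + k + n + k : ℕ) * P))⁻¹ := by
        push_cast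
        rw [add_mul, add_mul, add_mul, Real.exp_add, Real.exp_add, Real.exp_add, neg_mul,
          Real.exp_neg]
        have := (Real.exp_pos (i * P)).ne'
        have := (Real.exp_pos (n * P)).ne'
        have := (Real.exp_pos (k * P)).ne'
        have := (pos k).ne'
        field_simp
    _ ≤ (∑ w : Fin (i + k) → B, wt π α (Fin.append w v)) *
          (Sval π α k * Real.exp ((i + k + n + k : ℕ) * P))⁻¹ := by
        refine mul_le_mul_of_nonneg_right ?_ (inv_pos.2 (mul_pos (pos _) (Real.exp_pos _))).le
        exact (mul_le_mul_of_nonneg_right (hb i hi).1 hw).trans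
          (sum_wt_left hXS k hM π hα hi hn v)
    _ = ∑ w : Fin (i + k) → B, wt π α (Fin.append w v) *
          (Sval π α k * Real.exp ((i + k + n + k : ℕ) * P))⁻¹ := by rw [Finset.sum_mul]
    _ ≤ _ := by
        refine Finset.sum_le_sum fun w _ => ?_
        rw [← div_eq_mul_inv]
        exact hν (i + k + n) (by omega) _

lemma cesaro_real (ν : ProbabilityMeasure Y.pt) (μn : ProbabilityMeasure Y.pt) (n : ℕ)
    (h : μn.toMeasure = (n : ℝ≥0∞)⁻¹ • ∑ i ∈ Finset.range n, ν.toMeasure.map (Y.σ^[i]))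
    {E : Set Y.pt} (hE : MeasurableSet E) :
    μn.toMeasure.real E = (∑ i ∈ Finset.range n, ν.toMeasure.real (Y.σ^[i] ⁻¹' E)) / n := by
  rw [measureReal_def, h, Measure.smul_apply, Measure.finsetSum_apply, smul_eq_mul,
    ENNReal.toReal_mul, ENNReal.toReal_sum]
  · simp only [Measure.map_apply (measurable_sigma_iter Y _) hE]
    rw [ENNReal.toReal_inv, ENNReal.toReal_natCast, inv_mul_eq_div]
    rfl
  · intro i _
    rw [Measure.map_apply (measurable_sigma_iter Y _) hE]
    exact measure_ne_top _ _

lemma cesaro_inv (ν : ProbabilityMeasure Y.pt) (μs : ℕ → ProbabilityMeasure Y.pt)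
    (hμs : ∀ n : ℕ, 0 < n → (μs n).toMeasure
        = (n : ℝ≥0∞)⁻¹ • ∑ i ∈ Finset.range n, ν.toMeasure.map (Y.σ^[i]))
    (t : ℕ → ℕ) (ht : StrictMono t) (μ : ProbabilityMeasure Y.pt)
    (hμ : Tendsto (fun j => μs (t j)) atTop (𝓝 μ)) : μ ∈ invP Y := by
  change μ.toMeasure.map Y.σ = μ.toMeasure
  have : IsProbabilityMeasure (μ.toMeasure.map Y.σ) :=
    Measure.isProbabilityMeasure_map (measurable_sigma Y).aemeasurable
  refine ext_cyl Y _ _ fun n v => ?_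
  rw [map_measureReal_apply (measurable_sigma Y) (measurableSet_cyl Y v)]
  have hc := isClopen_cyl Y v
  have h1 := tendsto_real_clopen Y hμ hc
  have h2 := tendsto_real_clopen Y hμ (hc.preimage (continuous_sigma Y))
  have h3 := h2.sub h1
  have h4 : Tendsto (fun j => (μs (t j)).toMeasure.real (Y.σ ⁻¹' cyl Y v) -
      (μs (t j)).toMeasure.real (cyl Y v)) atTop (𝓝 0) := by
    have h5 : Tendsto (fun j => (1 : ℝ) / (t j : ℝ)) atTop (𝓝 0) :=
      (tendsto_const_div_atTop_nhds_zero_nat 1).comp ht.tendsto_atTop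
    refine squeeze_zero_norm' ?_ h5
    filter_upwards [ht.tendsto_atTop.eventually_ge_atTop 1] with j hj
    rw [cesaro_real ν _ _ (hμs _ hj) hc.1.measurableSet, cesaro_real ν _ _ (hμs _ hj)
      (measurable_sigma Y hc.1.measurableSet), ← sub_div, ← Finset.sum_sub_distrib]
    have e : ∀ i, Y.σ^[i] ⁻¹' (Y.σ ⁻¹' cyl Y v) = Y.σ^[i + 1] ⁻¹' cyl Y v := by
      intro i
      rw [← Set.preimage_comp, Function.iterate_succ']
    simp only [e]
    rw [Finset.sum_range_sub (fun i => ν.toMeasure.real (Y.σ^[i] ⁻¹' cyl Y v)), norm_div,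
      Real.norm_natCast]
    refine div_le_div_of_nonneg_right ?_ (Nat.cast_nonneg _)
    rw [Real.norm_eq_abs, abs_le]
    have a1 : ν.toMeasure.real (Y.σ^[t j] ⁻¹' cyl Y v) ≤ 1 := measureReal_le_one
    have a2 : ν.toMeasure.real (Y.σ^[0] ⁻¹' cyl Y v) ≤ 1 := measureReal_le_one
    have a3 : 0 ≤ ν.toMeasure.real (Y.σ^[t j] ⁻¹' cyl Y v) := measureReal_nonneg
    have a4 : 0 ≤ ν.toMeasure.real (Y.σ^[0] ⁻¹' cyl Y v) := measureReal_nonneg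
    constructor <;> linarith
  have := tendsto_nhds_unique h3 h4
  linarith

end Helpers



/-- (Lemma: if `ν` is a weak* limit of a subsequence of the measures
`ν_n` of Statement 14 and `μ_n = (1/n) Σ_{i<n} σ_Y^i ν`, then any weak* limit point `μ`
of `(μ_n)` is a `σ_Y`-invariant Gibbs measure for `Φ`). -/
theorem statement15
    {A B : Type*}
    [Fintype A] [TopologicalSpace A] [DiscreteTopology A]
    [MeasurableSpace A] [MeasurableSingletonClass A]
    [Fintype B] [TopologicalSpace B] [DiscreteTopology B]
    [MeasurableSpace B] [MeasurableSingletonClass B]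
    (X : Subshift A) (Y : Subshift B) (π : Factor X Y)
    (hXS : IsSFT X) (hYS : IsSFT Y) (hXM : Mix X) (hYM : Mix Y)
    (M : ℕ) (hM : MixGap X M)
    (α : ℝ) (hα : 0 < α)
    (P : ℝ)
    (hP : Filter.Tendsto (fun n : ℕ => Real.log (Sval π α n) / n) Filter.atTop (nhds P))
    (νseq : ℕ → ProbabilityMeasure Y.pt)
    (hν : ∀ n : ℕ, 0 < n → ∀ v : Fin n → B,
      ((νseq n).toMeasure (cyl Y v)).toReal
        = (preCnt π v : ℝ) ^ (1 / (α + 1) : ℝ) / Sval π α n)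
    -- `ν` is a weak* limit of a subsequence of `νseq`
    (s : ℕ → ℕ) (hs : StrictMono s) (ν : ProbabilityMeasure Y.pt)
    (hconv : Filter.Tendsto (fun j => νseq (s j)) Filter.atTop (nhds ν))
    -- `μs n` is the Cesàro average `(1/n) Σ_{i<n} σ_Y^i ν`
    (μs : ℕ → ProbabilityMeasure Y.pt)
    (hμs : ∀ n : ℕ, 0 < n →
      (μs n).toMeasure
        = (n : ℝ≥0∞)⁻¹ • ∑ i ∈ Finset.range n, ν.toMeasure.map (Y.σ^[i]))
    -- `μ` is a weak* limit point of `(μs)`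
    (t : ℕ → ℕ) (ht : StrictMono t) (μ : ProbabilityMeasure Y.pt)
    (hμ : Filter.Tendsto (fun j => μs (t j)) Filter.atTop (nhds μ)) :
    -- `μ` is σ_Y-invariant ...
    μ ∈ invP Y ∧
    -- ... and a Gibbs measure for Φ, with constants as in the paper:
    ∃ C' C'' : ℝ, 0 < C' ∧ 0 < C'' ∧
      ∀ n : ℕ, 0 < n → ∀ v : Fin n → B, allowW Y v →
        C' ≤ (μ.toMeasure (cyl Y v)).toReal /
            (Real.exp (-(n : ℝ) * P) * (preCnt π v : ℝ) ^ (1 / (α + 1) : ℝ)) ∧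
        (μ.toMeasure (cyl Y v)).toReal /
            (Real.exp (-(n : ℝ) * P) * (preCnt π v : ℝ) ^ (1 / (α + 1) : ℝ)) ≤ C'' := by
  refine ⟨cesaro_inv ν μs hμs t ht μ hμ, ?_⟩
  obtain ⟨k, hk⟩ : ∃ k, MixGap X (k + 1) := by
    rcases M with _ | k
    · exact ⟨0, mixGap_succ hM⟩
    · exact ⟨k, hM⟩
  obtain ⟨y⟩ : Nonempty Y.pt := nonempty_of_isProbabilityMeasure ν.toMeasure
  have pos := Sval_pos π α y
  have hνb := nu_bounds hXS k hk π hα y P hP νseq hν s hs ν hconv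
  have hup := shift_upper hXS k hk π hα y P hP ν (fun n hn v => (hνb n hn v).2)
  have hlo := shift_lower hXS k hk π hα y P hP ν (fun n hn v => (hνb n hn v).1)
  set c := (Sval π α k * Real.exp (k * P) * Real.exp (k * P))⁻¹ with hc
  have hcpos : 0 < c := inv_pos.2 (mul_pos (mul_pos (pos _) (Real.exp_pos _)) (Real.exp_pos _))
  have hKpos := pos k
  refine ⟨c / 2, Sval π α k ^ 2 + Sval π α k, by positivity, by positivity,
    fun n hn v hv => ?_⟩
  have hwpos : 0 < wt π α v :=
    Real.rpow_pos_of_pos (Nat.cast_pos.2 (preCnt_pos π v hv)) _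
  have hD : 0 < Real.exp (-(n : ℝ) * P) * wt π α v := mul_pos (Real.exp_pos _) hwpos
  have hlim := tendsto_real_clopen Y hμ (isClopen_cyl Y v)
  change c / 2 ≤ μ.toMeasure.real (cyl Y v) / (Real.exp (-(n : ℝ) * P) * wt π α v) ∧
    μ.toMeasure.real (cyl Y v) / (Real.exp (-(n : ℝ) * P) * wt π α v) ≤ _
  set D := Real.exp (-(n : ℝ) * P) * wt π α v with hDdef
  rw [le_div_iff₀ hD, div_le_iff₀ hD]
  constructor
  · refine ge_of_tendsto hlim ?_
    filter_upwards [ht.tendsto_atTop.eventually_ge_atTop (2 * (k + 1))] with j hj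
    rw [cesaro_real ν _ _ (hμs _ (by omega)) (measurableSet_cyl Y v)]
    obtain ⟨r, hr⟩ : ∃ r, t j = (k + 1) + r := ⟨t j - (k + 1), by omega⟩
    have htj : (0 : ℝ) < t j := by exact_mod_cast (show 0 < t j by omega)
    rw [le_div_iff₀ htj]
    have h2r : (t j : ℝ) ≤ 2 * r := by exact_mod_cast (show t j ≤ 2 * r by omega)
    calc c / 2 * D * t j ≤ c / 2 * D * (2 * r) :=
          mul_le_mul_of_nonneg_left h2r (by positivity)
      _ = ∑ i ∈ Finset.range r, c * D := by
          rw [Finset.sum_const, Finset.card_range, nsmul_eq_mul]; ring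
      _ ≤ ∑ i ∈ Finset.range r, ν.toMeasure.real (Y.σ^[(k + 1) + i] ⁻¹' cyl Y v) := by
          refine Finset.sum_le_sum fun i _ => ?_
          have := hlo n hn v (i + 1) (by omega)
          have e : k + 1 + i = i + 1 + k := by ring
          rw [e]; exact this
      _ ≤ _ := by
          rw [hr, Finset.sum_range_add]
          exact le_add_of_nonneg_left (Finset.sum_nonneg fun i _ => measureReal_nonneg)
  · refine le_of_tendsto hlim ?_
    filter_upwards [ht.tendsto_atTop.eventually_ge_atTop 1] with j hj
    rw [cesaro_real ν _ _ (hμs _ (by omega)) (measurableSet_cyl Y v)]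
    have htj : (0 : ℝ) < t j := by exact_mod_cast (show 0 < t j by omega)
    rw [div_le_iff₀ htj]
    calc ∑ i ∈ Finset.range (t j), ν.toMeasure.real (Y.σ^[i] ⁻¹' cyl Y v)
        ≤ ∑ i ∈ Finset.range (t j), (Sval π α k ^ 2 + Sval π α k) * D := by
          refine Finset.sum_le_sum fun i _ => ?_
          rcases Nat.eq_zero_or_pos i with rfl | hi
          · have h := (hνb n hn v).2
            have e : wt π α v * Sval π α k / Real.exp (n * P) = Sval π α k * D := by
              rw [hDdef, neg_mul, Real.exp_neg]; ring
            rw [e] at h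
            refine h.trans (mul_le_mul_of_nonneg_right ?_ hD.le)
            nlinarith
          · refine (hup n hn v i hi).trans (mul_le_mul_of_nonneg_right ?_ hD.le)
            linarith
      _ = _ := by rw [Finset.sum_const, Finset.card_range, nsmul_eq_mul]; ring
end Paper
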